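/- Let δ ≥ 1 and let H be a proper δ-hyperbolic Busemann space with fixed base point w ∈ H and boundary point a ∈ ∂H. Let x, y ∈ H with h(x) ≤ h(y), and let α be a path connecting x to y with h⁺(α) ≤ h(y) + ½·d_r(x,y) − ΔH, where ΔH > 555δ. Then l(α) ≥ d(x,y) + 2^{−530}·2^{ΔH/δ} − 2ΔH − 24δ. -/

import Mathlib

open Set Filter
open scoped ENNReal NNReal

noncomputable section

namespace HP

variable {H : Type*} [MetricSpace H]

/-- `γ` restricted to `I` is an arclength-parametrised (isometric) geodesic. -/
def IsGeodesicOn (γ : ℝ → H) (I : Set ℝ) : Prop :=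
  ∀ s ∈ I, ∀ t ∈ I, dist (γ s) (γ t) = |s - t|

/-- A geodesic line of `H`. -/
def IsGeodesicLine (γ : ℝ → H) : Prop := IsGeodesicOn γ Set.univ

/-- A geodesic ray of `H`, parametrised on `[0,∞)`. -/
def IsGeodesicRay (γ : ℝ → H) : Prop := IsGeodesicOn γ (Set.Ici 0)

/-- A geodesic ray starting at `w`. -/
def IsRayFrom (w : H) (γ : ℝ → H) : Prop := IsGeodesicRay γ ∧ γ 0 = w

/-- A geodesic segment from `x` to `y`, parametrised on `[0, dist x y]`. -/
def IsGeodSegment (γ : ℝ → H) (x y : H) : Prop :=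
  IsGeodesicOn γ (Set.Icc 0 (dist x y)) ∧ γ 0 = x ∧ γ (dist x y) = y

/-- The traces on `[0,∞)` of two rays are at finite Hausdorff distance. -/
def FinHausRays (γ₁ γ₂ : ℝ → H) : Prop :=
  ∃ C : ℝ, (∀ s : ℝ, 0 ≤ s → ∃ t : ℝ, 0 ≤ t ∧ dist (γ₁ s) (γ₂ t) ≤ C) ∧
           (∀ t : ℝ, 0 ≤ t → ∃ s : ℝ, 0 ≤ s ∧ dist (γ₁ s) (γ₂ t) ≤ C)

/-- A geodesic metric space: any two points are joined by a geodesic segment. -/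
def GeodesicSpace (H : Type*) [MetricSpace H] : Prop :=
  ∀ x y : H, ∃ γ : ℝ → H, IsGeodSegment γ x y

/-- `δ`-hyperbolicity: geodesic space all of whose geodesic triangles are `δ`-slim,
i.e. each side is contained in the `δ`-neighbourhood of the union of the other two. -/
def DeltaHyperbolic (H : Type*) [MetricSpace H] (δ : ℝ) : Prop :=
  GeodesicSpace H ∧
  ∀ x y z : H, ∀ γ₁ γ₂ γ₃ : ℝ → H,
    IsGeodSegment γ₁ x y → IsGeodSegment γ₂ y z → IsGeodSegment γ₃ z x →
    ∀ s ∈ Set.Icc (0:ℝ) (dist x y),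
      ∃ u ∈ γ₂ '' Set.Icc (0:ℝ) (dist y z) ∪ γ₃ '' Set.Icc (0:ℝ) (dist z x),
        dist (γ₁ s) u ≤ δ

/-- A Busemann space: geodesic, and the distance between any two
arclength-parametrised geodesics is a convex function. -/
def BusemannSpace (H : Type*) [MetricSpace H] : Prop :=
  GeodesicSpace H ∧
  ∀ (a b a' b' : ℝ) (γ γ' : ℝ → H),
    IsGeodesicOn γ (Set.Icc a b) → IsGeodesicOn γ' (Set.Icc a' b') →
    ConvexOn ℝ (Set.Icc a b ×ˢ Set.Icc a' b')
      (fun p : ℝ × ℝ => dist (γ p.1) (γ' p.2))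

/-- Geodesic completeness: every geodesic segment extends to a geodesic line. -/
def GeodesicallyComplete (H : Type*) [MetricSpace H] : Prop :=
  ∀ (a b : ℝ) (γ : ℝ → H), a ≤ b → IsGeodesicOn γ (Set.Icc a b) →
    ∃ γ' : ℝ → H, IsGeodesicLine γ' ∧ ∀ t ∈ Set.Icc a b, γ' t = γ t

/-- The Busemann function with respect to the boundary point represented by the
geodesic ray `aRep` and the base point `w`. -/
def busemann (w : H) (aRep : ℝ → H) (x : H) : ℝ :=
  sSup { b : ℝ | ∃ k : ℝ → H, IsRayFrom w k ∧ FinHausRays aRep k ∧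
    b = Filter.limsup (fun t => dist x (k t) - t) Filter.atTop }

/-- The height function: minus the Busemann function. -/
def height (w : H) (aRep : ℝ → H) (x : H) : ℝ := - busemann w aRep x

/-- A vertical geodesic (forward oriented): a geodesic line whose height tends to `+∞`. -/
def IsVerticalGeodesic (w : H) (aRep : ℝ → H) (V : ℝ → H) : Prop :=
  IsGeodesicLine V ∧ Tendsto (fun t => height w aRep (V t)) atTop atTop

/-- A vertical geodesic line (either orientation): a geodesic line whose image lies
in the boundary class, i.e. whose height tends to `+∞` along one of its ends. -/
def IsVerticalGeodesicLine (w : H) (aRep : ℝ → H) (V : ℝ → H) : Prop :=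
  IsGeodesicLine V ∧
    (Tendsto (fun t => height w aRep (V t)) atTop atTop ∨
     Tendsto (fun t => height w aRep (V t)) atBot atTop)

/-- A vertical geodesic parametrised by its height: `h(V(t)) = t` for all `t`. -/
def VertParam (w : H) (aRep : ℝ → H) (V : ℝ → H) : Prop :=
  IsGeodesicLine V ∧ ∀ t : ℝ, height w aRep (V t) = t

/-- Height difference `Δh(x,y)`. -/
def dh (w : H) (aRep : ℝ → H) (x y : H) : ℝ :=
  |height w aRep x - height w aRep y|

/-- Relative distance `d_r(x,y) = d(x,y) - Δh(x,y)`. -/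
def dr (w : H) (aRep : ℝ → H) (x y : H) : ℝ := dist x y - dh w aRep x y

/-- Maximal height `h⁺` of a path along the parameter set `I`. -/
def hplusOn (w : H) (aRep : ℝ → H) (γ : ℝ → H) (I : Set ℝ) : ℝ :=
  sSup ((fun t => height w aRep (γ t)) '' I)

/-- Minimal height `h⁻` of a path along the parameter set `I`. -/
def hminusOn (w : H) (aRep : ℝ → H) (γ : ℝ → H) (I : Set ℝ) : ℝ :=
  sInf ((fun t => height w aRep (γ t)) '' I)

/-- A path parametrised by arclength: the length of the piece on `[s,t]` equals `t - s`. -/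
def ArclengthPath (V : ℝ → H) : Prop :=
  ∀ s t : ℝ, s ≤ t → eVariationOn V (Set.Icc s t) = ENNReal.ofReal (t - s)

/-- An admissible norm on `ℝ²`: a norm with `N(1,1) = 1` and `N(a,b) ≥ (a+b)/2`. -/
structure AdmNorm where
  toFun : ℝ × ℝ → ℝ
  eq_zero_iff : ∀ v : ℝ × ℝ, toFun v = 0 ↔ v = 0
  smul_eq : ∀ (c : ℝ) (v : ℝ × ℝ), toFun (c • v) = |c| * toFun v
  add_le : ∀ v w : ℝ × ℝ, toFun (v + w) ≤ toFun v + toFun w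
  one_one : toFun (1, 1) = 1
  adm : ∀ a b : ℝ, (a + b) / 2 ≤ toFun (a, b)

/-- `C` is a comparison constant `C_N` for the admissible norm `N`:
`C ≥ 1` and `N(a,b) ≤ C(a+b)/2` for all `a,b ≥ 0`. -/
def AdmNorm.BoundConst (N : AdmNorm) (C : ℝ) : Prop :=
  1 ≤ C ∧ ∀ a b : ℝ, 0 ≤ a → 0 ≤ b → N.toFun (a, b) ≤ C * (a + b) / 2

variable {Hp Hq : Type*} [MetricSpace Hp] [MetricSpace Hq]

/-- Membership in the horospherical product: `h_p(x_p) + h_q(x_q) = 0`. -/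
def inHoro (wp : Hp) (ap : ℝ → Hp) (wq : Hq) (aq : ℝ → Hq) (z : Hp × Hq) : Prop :=
  height wp ap z.1 + height wq aq z.2 = 0

/-- The `N`-length of a path in `Hp × Hq`: supremum over finite monotone
subdivisions of the sums of the `N(d_p, d_q)`-distances. -/
def lN (Nf : ℝ × ℝ → ℝ) (γ : ℝ → Hp × Hq) (s : Set ℝ) : ℝ≥0∞ :=
  ⨆ p : ℕ × { u : ℕ → ℝ // Monotone u ∧ ∀ i, u i ∈ s },
    ∑ i ∈ Finset.range p.1,
      ENNReal.ofReal (Nf (dist (γ (p.2.1 (i+1))).1 (γ (p.2.1 i)).1,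
                          dist (γ (p.2.1 (i+1))).2 (γ (p.2.1 i)).2))

/-- The `N`-path metric: infimum of `N`-lengths of connected paths staying in the
horospherical product and joining the two points. -/
def dHN (Nf : ℝ × ℝ → ℝ) (mem : Hp × Hq → Prop) (x y : Hp × Hq) : ℝ≥0∞ :=
  ⨅ (T : ℝ) (_ : 0 ≤ T) (γ : ℝ → Hp × Hq) (_ : ContinuousOn γ (Set.Icc 0 T))
    (_ : ∀ t ∈ Set.Icc (0:ℝ) T, mem (γ t)) (_ : γ 0 = x) (_ : γ T = y),
    lN Nf γ (Set.Icc 0 T)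

/-- A geodesic of the horospherical product with respect to the `N`-path metric,
parametrised (by arclength) on `I` and staying in the product. -/
def IsHNGeodesicOn (Nf : ℝ × ℝ → ℝ) (mem : Hp × Hq → Prop)
    (α : ℝ → Hp × Hq) (I : Set ℝ) : Prop :=
  (∀ t ∈ I, mem (α t)) ∧
  ∀ s ∈ I, ∀ t ∈ I, dHN Nf mem (α s) (α t) = ENNReal.ofReal |s - t|

/-- A vertical geodesic of the horospherical product, parametrised by its height. -/
def IsHNVerticalLine (Nf : ℝ × ℝ → ℝ) (mem : Hp × Hq → Prop)
    (wp : Hp) (ap : ℝ → Hp) (V : ℝ → Hp × Hq) : Prop :=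
  IsHNGeodesicOn Nf mem V Set.univ ∧ ∀ t : ℝ, height wp ap (V t).1 = t

/-- Maximal height `h⁺` of a path of the horospherical product. -/
def hplusH (wp : Hp) (ap : ℝ → Hp) (γ : ℝ → Hp × Hq) (I : Set ℝ) : ℝ :=
  sSup ((fun t => height wp ap (γ t).1) '' I)

/-- Minimal height `h⁻` of a path of the horospherical product. -/
def hminusH (wp : Hp) (ap : ℝ → Hp) (γ : ℝ → Hp × Hq) (I : Set ℝ) : ℝ :=
  sInf ((fun t => height wp ap (γ t).1) '' I)

/-- `H_p`-type path at scale `κ`: the first component stays `κ`-close to a geodesic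
of `H_p` and the second component stays `κ`-close to a vertical geodesic of `H_q`. -/
def IsHpType (wq : Hq) (aq : ℝ → Hq) (κ : ℝ) (α : ℝ → Hp × Hq) : Prop :=
  (∃ g : ℝ → Hp, IsGeodesicLine g ∧ ∀ t : ℝ, ∃ s : ℝ, dist (α t).1 (g s) ≤ κ) ∧
  (∃ v : ℝ → Hq, IsVerticalGeodesicLine wq aq v ∧ ∀ t : ℝ, ∃ s : ℝ, dist (α t).2 (v s) ≤ κ)

/-- `H_q`-type path at scale `κ`. -/
def IsHqType (wp : Hp) (ap : ℝ → Hp) (κ : ℝ) (α : ℝ → Hp × Hq) : Prop :=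
  (∃ g : ℝ → Hq, IsGeodesicLine g ∧ ∀ t : ℝ, ∃ s : ℝ, dist (α t).2 (g s) ≤ κ) ∧
  (∃ v : ℝ → Hp, IsVerticalGeodesicLine wp ap v ∧ ∀ t : ℝ, ∃ s : ℝ, dist (α t).1 (v s) ≤ κ)

/-- Finite Hausdorff distance on `[0,∞)` between two rays, for a generalized
(`ℝ≥0∞`-valued) distance `dd`. -/
def HNFinHaus {X : Type*} (dd : X → X → ℝ≥0∞) (α β : ℝ → X) : Prop :=
  ∃ C : ℝ, (∀ s : ℝ, 0 ≤ s → ∃ t : ℝ, 0 ≤ t ∧ dd (α s) (β t) ≤ ENNReal.ofReal C) ∧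
           (∀ t : ℝ, 0 ≤ t → ∃ s : ℝ, 0 ≤ s ∧ dd (α s) (β t) ≤ ENNReal.ofReal C)

theorem finHaus_equivalence (H : Type*) [MetricSpace H] :
    Equivalence (fun γ₁ γ₂ : {γ : ℝ → H // IsGeodesicRay γ} => FinHausRays γ₁.1 γ₂.1) := by
  constructor
  · intro γ
    exact ⟨0, fun s hs => ⟨s, hs, by simp⟩, fun t ht => ⟨t, ht, by simp⟩⟩
  · rintro γ₁ γ₂ ⟨C, h1, h2⟩
    refine ⟨C, fun s hs => ?_, fun t ht => ?_⟩
    · obtain ⟨u, hu, hd⟩ := h2 s hs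
      exact ⟨u, hu, by rwa [dist_comm]⟩
    · obtain ⟨u, hu, hd⟩ := h1 t ht
      exact ⟨u, hu, by rwa [dist_comm]⟩
  · rintro γ₁ γ₂ γ₃ ⟨C, h1, h2⟩ ⟨D, g1, g2⟩
    refine ⟨C + D, fun s hs => ?_, fun t ht => ?_⟩
    · obtain ⟨u, hu, hd⟩ := h1 s hs
      obtain ⟨v, hv, he⟩ := g1 u hu
      exact ⟨v, hv, (dist_triangle _ (γ₂.1 u) _).trans (add_le_add hd he)⟩
    · obtain ⟨u, hu, hd⟩ := g2 t ht
      obtain ⟨v, hv, he⟩ := h2 u hu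
      exact ⟨v, hv, (dist_triangle _ (γ₂.1 u) _).trans (add_le_add he hd)⟩

/-- The setoid of geodesic rays up to finite Hausdorff distance. -/
instance raySetoid (H : Type*) [MetricSpace H] : Setoid {γ : ℝ → H // IsGeodesicRay γ} :=
  ⟨fun γ₁ γ₂ => FinHausRays γ₁.1 γ₂.1, finHaus_equivalence H⟩

/-- The Gromov boundary: equivalence classes of geodesic rays at finite
Hausdorff distance. -/
abbrev Bdry (H : Type*) [MetricSpace H] := Quotient (raySetoid H)

/-- The boundary point determined by a geodesic ray. -/
def bdryPt {H : Type*} [MetricSpace H] (γ : ℝ → H) (h : IsGeodesicRay γ) : Bdry H :=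
  Quotient.mk (raySetoid H) ⟨γ, h⟩

/-- The set `((∂H_p ∖ {a_p}) × {a_q}) ∪ ({a_p} × (∂H_q ∖ {a_q}))`. -/
def bdryTarget {Hp Hq : Type*} [MetricSpace Hp] [MetricSpace Hq]
    (ap : ℝ → Hp) (hap : IsGeodesicRay ap)
    (aq : ℝ → Hq) (haq : IsGeodesicRay aq) : Set (Bdry Hp × Bdry Hq) :=
  ((({bdryPt ap hap} : Set (Bdry Hp))ᶜ ×ˢ ({bdryPt aq haq} : Set (Bdry Hq))) ∪
   (({bdryPt ap hap} : Set (Bdry Hp)) ×ˢ ({bdryPt aq haq} : Set (Bdry Hq))ᶜ))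

open Topology

/-- `q` lies on some geodesic segment from `x` to `y`. -/
def OnGeodSegment (x y q : H) : Prop :=
  ∃ γ : ℝ → H, IsGeodSegment γ x y ∧ ∃ p ∈ Set.Icc (0 : ℝ) (dist x y), γ p = q

theorem IsGeodSegment.reverse {γ : ℝ → H} {x y : H} (h : IsGeodSegment γ x y) :
    IsGeodSegment (fun t => γ (dist x y - t)) y x := by
  obtain ⟨h1, h2, h3⟩ := h
  refine ⟨fun s hs t ht => ?_, by simpa using h3, by simpa [dist_comm y x] using h2⟩
  rw [dist_comm y x] at hs ht
  rw [h1 _ ⟨by linarith [hs.2], by linarith [hs.1]⟩ _ ⟨by linarith [ht.2], by linarith [ht.1]⟩,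
    abs_sub_comm]
  congr 1
  ring

theorem OnGeodSegment.symm {x y q : H} (h : OnGeodSegment x y q) : OnGeodSegment y x q := by
  obtain ⟨γ, hγ, p, hp, rfl⟩ := h
  refine ⟨_, hγ.reverse, dist x y - p, ?_, by simp⟩
  rw [dist_comm y x]
  exact ⟨by linarith [hp.2], by linarith [hp.1]⟩

theorem IsGeodSegment.dist_left {γ : ℝ → H} {x y : H} (h : IsGeodSegment γ x y) {p : ℝ}
    (hp : p ∈ Set.Icc (0 : ℝ) (dist x y)) : dist x (γ p) = p := by
  obtain ⟨h1, h2, -⟩ := h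
  have := h1 0 ⟨le_rfl, dist_nonneg⟩ p hp
  rwa [h2, zero_sub, abs_neg, abs_of_nonneg hp.1] at this

theorem IsGeodSegment.dist_right {γ : ℝ → H} {x y : H} (h : IsGeodSegment γ x y) {p : ℝ}
    (hp : p ∈ Set.Icc (0 : ℝ) (dist x y)) : dist (γ p) y = dist x y - p := by
  obtain ⟨h1, -, h3⟩ := h
  have := h1 p hp (dist x y) ⟨dist_nonneg, le_rfl⟩
  rwa [h3, abs_sub_comm, abs_of_nonneg (by linarith [hp.2])] at this

theorem OnGeodSegment.dist_add {x y q : H} (h : OnGeodSegment x y q) :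
    dist x q + dist q y = dist x y := by
  obtain ⟨γ, hγ, p, hp, rfl⟩ := h
  rw [hγ.dist_left hp, hγ.dist_right hp]
  ring

theorem DeltaHyperbolic.exists_near {δ : ℝ} (hH : DeltaHyperbolic H δ) {x y q : H}
    (h : OnGeodSegment x y q) (z : H) :
    ∃ u, (OnGeodSegment x z u ∨ OnGeodSegment z y u) ∧ dist q u ≤ δ := by
  obtain ⟨γ, hγ, p, hp, rfl⟩ := h
  obtain ⟨γ₂, h₂⟩ := hH.1 y z
  obtain ⟨γ₃, h₃⟩ := hH.1 z x
  obtain ⟨u, hu, hd⟩ := hH.2 x y z γ γ₂ γ₃ hγ h₂ h₃ p hp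
  refine ⟨u, ?_, hd⟩
  rcases hu with ⟨r, hr, hru⟩ | ⟨r, hr, hru⟩
  · exact Or.inr (OnGeodSegment.symm ⟨γ₂, h₂, r, hr, hru⟩)
  · exact Or.inl (OnGeodSegment.symm ⟨γ₃, h₃, r, hr, hru⟩)

theorem eVariationOn_Icc_le_of_forall_left {α : ℝ → H} {s r : ℝ} {L : ℝ≥0∞}
    (hc : ContinuousOn α (Set.Icc s r))
    (hL : ∀ i ∈ Set.Ioo s r, eVariationOn α (Set.Icc s i) ≤ L) :
    eVariationOn α (Set.Icc s r) ≤ L := by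
  rcases le_or_gt r s with hrs | hsr
  · rw [eVariationOn.subsingleton α (Set.subsingleton_Icc_of_ge hrs)]
    exact zero_le
  by_contra! hlt
  have hev : ∀ᶠ i in 𝓝[<] r, i ∈ Set.Ioo s r := Ioo_mem_nhdsLT hsr
  have hlim : ∀ x ∈ Set.Icc s r, Tendsto (fun i => (α ∘ fun x => min x i) x) (𝓝[<] r)
      (𝓝 (α x)) := by
    intro x hx
    refine (hc x hx).tendsto.comp (tendsto_nhdsWithin_iff.2 ⟨?_, ?_⟩)
    · have : Tendsto (fun i => min x i) (𝓝 r) (𝓝 (min x r)) :=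
        (continuous_const.min continuous_id).tendsto r
      rw [min_eq_left hx.2] at this
      exact this.mono_left nhdsWithin_le_nhds
    · filter_upwards [hev] with i hi
      exact ⟨le_min hx.1 hi.1.le, (min_le_left _ _).trans hx.2⟩
  obtain ⟨i, hi, hi'⟩ := ((eVariationOn.lowerSemicontinuous_aux hlim hlt).and hev).exists
  refine absurd (hL i hi') (not_le.2 (hi.trans_le ?_))
  exact eVariationOn.comp_le_of_monotoneOn α _ (fun _ _ _ _ h => min_le_min_right _ h)
    fun x hx => ⟨le_min hx.1 hi'.1.le, min_le_right _ _⟩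

theorem eVariationOn_Icc_le_of_forall_right {α : ℝ → H} {r t : ℝ} {L : ℝ≥0∞}
    (hc : ContinuousOn α (Set.Icc r t))
    (hL : ∀ i ∈ Set.Ioo r t, eVariationOn α (Set.Icc i t) ≤ L) :
    eVariationOn α (Set.Icc r t) ≤ L := by
  rcases le_or_gt t r with hrs | hsr
  · rw [eVariationOn.subsingleton α (Set.subsingleton_Icc_of_ge hrs)]
    exact zero_le
  by_contra! hlt
  have hev : ∀ᶠ i in 𝓝[>] r, i ∈ Set.Ioo r t := Ioo_mem_nhdsGT hsr
  have hlim : ∀ x ∈ Set.Icc r t, Tendsto (fun i => (α ∘ fun x => max x i) x) (𝓝[>] r)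
      (𝓝 (α x)) := by
    intro x hx
    refine (hc x hx).tendsto.comp (tendsto_nhdsWithin_iff.2 ⟨?_, ?_⟩)
    · have : Tendsto (fun i => max x i) (𝓝 r) (𝓝 (max x r)) :=
        (continuous_const.max continuous_id).tendsto r
      rw [max_eq_left hx.1] at this
      exact this.mono_left nhdsWithin_le_nhds
    · filter_upwards [hev] with i hi
      exact ⟨hx.1.trans (le_max_left _ _), max_le hx.2 hi.2.le⟩
  obtain ⟨i, hi, hi'⟩ := ((eVariationOn.lowerSemicontinuous_aux hlim hlt).and hev).exists
  refine absurd (hL i hi') (not_le.2 (hi.trans_le ?_))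
  exact eVariationOn.comp_le_of_monotoneOn α _ (fun _ _ _ _ h => max_le_max_right _ h)
    fun x hx => ⟨le_max_right _ _, max_le hx.2 hi'.2.le⟩

theorem eVariationOn_Icc_add_Icc (α : ℝ → H) {s r t : ℝ} (h1 : s ≤ r) (h2 : r ≤ t) :
    eVariationOn α (Set.Icc s r) + eVariationOn α (Set.Icc r t)
      = eVariationOn α (Set.Icc s t) := by
  simpa using eVariationOn.Icc_add_Icc α h1 h2 (Set.mem_univ r)

/-- A continuous path of length at most `2 * L` splits into two pieces of length at most `L`. -/
theorem exists_eVariationOn_halves {α : ℝ → H} {s t : ℝ} (hst : s ≤ t)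
    (hc : ContinuousOn α (Set.Icc s t)) {L : ℝ≥0∞} (hLt : L ≠ ⊤)
    (hV : eVariationOn α (Set.Icc s t) ≤ 2 * L) :
    ∃ r ∈ Set.Icc s t, eVariationOn α (Set.Icc s r) ≤ L ∧ eVariationOn α (Set.Icc r t) ≤ L := by
  let A : Set ℝ := {r | r ∈ Set.Icc s t ∧ eVariationOn α (Set.Icc s r) ≤ L}
  have hsA : s ∈ A := ⟨⟨le_rfl, hst⟩, by
    rw [eVariationOn.subsingleton α (Set.subsingleton_Icc_of_ge le_rfl)]; exact zero_le⟩
  have hbdd : BddAbove A := ⟨t, fun r hr => hr.1.2⟩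
  have hsr : s ≤ sSup A := le_csSup hbdd hsA
  have hrt : sSup A ≤ t := csSup_le ⟨s, hsA⟩ fun r hr => hr.1.2
  refine ⟨sSup A, ⟨hsr, hrt⟩, ?_, ?_⟩
  · refine eVariationOn_Icc_le_of_forall_left (hc.mono (Set.Icc_subset_Icc_right hrt)) ?_
    intro i hi
    obtain ⟨b, hb, hib⟩ := exists_lt_of_lt_csSup ⟨s, hsA⟩ hi.2
    exact (eVariationOn.mono α (Set.Icc_subset_Icc_right hib.le)).trans hb.2
  · refine eVariationOn_Icc_le_of_forall_right (hc.mono (Set.Icc_subset_Icc_left hsr)) ?_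
    intro i hi
    have hsi : s ≤ i := hsr.trans hi.1.le
    have hL : L < eVariationOn α (Set.Icc s i) := by
      by_contra! hle
      exact absurd (le_csSup hbdd (show i ∈ A from ⟨⟨hsi, hi.2.le⟩, hle⟩)) (not_le.2 hi.1)
    rw [← eVariationOn_Icc_add_Icc α hsi hi.2.le, two_mul] at hV
    exact (ENNReal.add_le_add_iff_left hLt).1 ((add_le_add_left hL.le _).trans hV)

/-- In a `δ`-hyperbolic space, a geodesic joining the endpoints of a path of length at most `2 ^ n`
stays within `n * δ + 1` of the path. -/
theorem DeltaHyperbolic.exists_near_path {δ : ℝ} (hH : DeltaHyperbolic H δ) {α : ℝ → H} (n : ℕ) :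
    ∀ {s t : ℝ}, s ≤ t → ContinuousOn α (Set.Icc s t) →
      eVariationOn α (Set.Icc s t) ≤ 2 ^ n → ∀ {q : H}, OnGeodSegment (α s) (α t) q →
      ∃ r ∈ Set.Icc s t, dist q (α r) ≤ n * δ + 1 := by
  induction n with
  | zero =>
    intro s t hst _ hV q hq
    refine ⟨s, ⟨le_rfl, hst⟩, ?_⟩
    have h1 : edist (α s) (α t) ≤ 1 := by
      simpa using (eVariationOn.edist_le α (Set.left_mem_Icc.2 hst)
        (Set.right_mem_Icc.2 hst)).trans hV
    have h2 : dist (α s) (α t) ≤ 1 := by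
      rw [edist_dist] at h1
      exact ENNReal.ofReal_le_one.1 h1
    have := hq.dist_add
    have h3 : 0 ≤ dist q (α t) := dist_nonneg
    rw [dist_comm]
    push_cast
    linarith
  | succ n ih =>
    intro s t hst hc hV q hq
    obtain ⟨r, hr, hr1, hr2⟩ := exists_eVariationOn_halves hst hc (L := 2 ^ n) (by finiteness)
      (by rwa [← pow_succ'])
    obtain ⟨u, hu, hqu⟩ := hH.exists_near hq (α r)
    push_cast
    rcases hu with hu | hu
    · obtain ⟨i, hi, hd⟩ := ih hr.1 (hc.mono (Set.Icc_subset_Icc_right hr.2)) hr1 hu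
      exact ⟨i, ⟨hi.1, hi.2.trans hr.2⟩, by linarith [dist_triangle q u (α i)]⟩
    · obtain ⟨i, hi, hd⟩ := ih hr.2 (hc.mono (Set.Icc_subset_Icc_left hr.1)) hr2 hu
      exact ⟨i, ⟨hr.1.trans hi.1, hi.2⟩, by linarith [dist_triangle q u (α i)]⟩

theorem IsRayFrom.dist_eq {w : H} {k : ℝ → H} (hk : IsRayFrom w k) {t : ℝ} (ht : 0 ≤ t) :
    dist w (k t) = t := by
  have := hk.1 0 Set.self_mem_Ici t ht
  rwa [hk.2, zero_sub, abs_neg, abs_of_nonneg ht] at this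

/-- In a Busemann space, asymptotic rays with the same origin coincide. -/
theorem BusemannSpace.ray_unique (hB : BusemannSpace H) {w : H} {a k : ℝ → H}
    (ha : IsRayFrom w a) (hk : IsRayFrom w k) (hak : FinHausRays a k) {t : ℝ} (ht : 0 ≤ t) :
    a t = k t := by
  obtain ⟨C, hC, -⟩ := hak
  have hbound : ∀ s, 0 ≤ s → dist (a s) (k s) ≤ 2 * C := by
    intro s hs
    obtain ⟨u, hu, hd⟩ := hC s hs
    have h1 : dist (k u) (k s) ≤ C := by
      rw [hk.1 u hu s hs, ← hk.dist_eq hu, ← ha.dist_eq hs, dist_comm w, dist_comm w]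
      refine (abs_dist_sub_le _ _ _).trans ?_
      rwa [dist_comm]
    linarith [dist_triangle (a s) (k u) (k s)]
  have hconv : ∀ S, t < S → dist (a t) (k t) ≤ 2 * C * t / S := by
    intro S hS
    have hS0 : 0 < S := ht.trans_lt hS
    have hsub : Set.Icc 0 S ⊆ Set.Ici (0 : ℝ) := fun _ h => h.1
    have hcvx := hB.2 0 S 0 S a k (fun s hs r hr => ha.1 s (hsub hs) r (hsub hr))
      (fun s hs r hr => hk.1 s (hsub hs) r (hsub hr))
    have h0 : ((0, 0) : ℝ × ℝ) ∈ Set.Icc 0 S ×ˢ Set.Icc 0 S := by simp [hS0.le]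
    have h1 : ((S, S) : ℝ × ℝ) ∈ Set.Icc 0 S ×ˢ Set.Icc 0 S := by simp [hS0.le]
    have hle : 0 ≤ 1 - t / S := by rw [sub_nonneg, div_le_one hS0]; exact hS.le
    have h := hcvx.2 h0 h1 hle (div_nonneg ht hS0.le) (sub_add_cancel _ _)
    simp only [Prod.smul_mk, Prod.mk_add_mk, smul_eq_mul, mul_zero, zero_add,
      div_mul_cancel₀ _ hS0.ne', ha.2, hk.2, dist_self] at h
    calc dist (a t) (k t) ≤ t / S * dist (a S) (k S) := h
      _ ≤ t / S * (2 * C) := by gcongr; exact hbound S hS0.le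
      _ = 2 * C * t / S := by ring
  have hlim : Tendsto (fun S : ℝ => 2 * C * t / S) atTop (𝓝 0) :=
    tendsto_const_nhds.div_atTop tendsto_id
  have := ge_of_tendsto hlim ((eventually_gt_atTop t).mono hconv)
  exact dist_le_zero.1 this

/-- In a Busemann space, the Busemann function is an honest limit along the defining ray. -/
theorem BusemannSpace.tendsto_busemann (hB : BusemannSpace H) {w : H} {a : ℝ → H}
    (ha : IsRayFrom w a) (x : H) :
    Tendsto (fun t => dist x (a t) - t) atTop (𝓝 (busemann w a x)) := by
  have hanti : Antitone fun t : ℝ => dist x (a (max t 0)) - max t 0 := by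
    intro s t hst
    have h1 := ha.1 (max s 0) (le_max_right s 0) (max t 0) (le_max_right t 0)
    have h2 : max s 0 ≤ max t 0 := max_le_max_right _ hst
    rw [abs_sub_comm, abs_of_nonneg (by linarith)] at h1
    have := dist_triangle x (a (max s 0)) (a (max t 0))
    dsimp only
    linarith
  have hbdd : BddBelow (Set.range fun t : ℝ => dist x (a (max t 0)) - max t 0) := by
    refine ⟨-dist w x, ?_⟩
    rintro _ ⟨t, rfl⟩
    have h1 := ha.dist_eq (le_max_right t 0)
    have := dist_triangle w x (a (max t 0))
    dsimp only
    linarith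
  have hlim := tendsto_atTop_ciInf hanti hbdd
  have hlim' : Tendsto (fun t => dist x (a t) - t) atTop
      (𝓝 (⨅ t : ℝ, dist x (a (max t 0)) - max t 0)) := by
    refine hlim.congr' ?_
    filter_upwards [eventually_ge_atTop 0] with t ht
    rw [max_eq_left ht]
  suffices h : busemann w a x = ⨅ t : ℝ, dist x (a (max t 0)) - max t 0 by rwa [h]
  rw [busemann]
  refine (congrArg sSup ?_).trans (csSup_singleton _)
  ext b
  simp only [Set.mem_ofPred_eq, Set.mem_singleton_iff]
  constructor
  · rintro ⟨k, hk, hak, rfl⟩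
    rw [← hlim'.limsup_eq]
    refine limsup_congr ?_
    filter_upwards [eventually_ge_atTop 0] with t ht
    rw [hB.ray_unique ha hk hak ht]
  · rintro rfl
    exact ⟨a, ha, ⟨0, fun s hs => ⟨s, hs, by simp⟩, fun t ht => ⟨t, ht, by simp⟩⟩,
      hlim'.limsup_eq.symm⟩

theorem BusemannSpace.height_sub_le_dist (hB : BusemannSpace H) {w : H} {a : ℝ → H}
    (ha : IsRayFrom w a) (x y : H) : height w a x - height w a y ≤ dist x y := by
  have : busemann w a y ≤ dist x y + busemann w a x := by
    refine le_of_tendsto_of_tendsto' (hB.tendsto_busemann ha y)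
      ((hB.tendsto_busemann ha x).const_add (dist x y)) fun t => ?_
    have := dist_triangle y x (a t)
    rw [dist_comm y x] at this
    linarith
  simp only [height]
  linarith

/-- A point of a geodesic segment lies almost as high as it would on one of the two vertical
rays issued from the endpoints. -/
theorem DeltaHyperbolic.min_height_le (hB : BusemannSpace H) {δ : ℝ} (hH : DeltaHyperbolic H δ)
    {w : H} {a : ℝ → H} (ha : IsRayFrom w a) {x y m : H} (hm : OnGeodSegment x y m) :
    min (height w a x + dist x m) (height w a y + dist m y) - 2 * δ ≤ height w a m := by
  have hle : busemann w a m ≤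
      max (2 * δ + busemann w a x - dist x m) (2 * δ + busemann w a y - dist m y) := by
    have hx := ((hB.tendsto_busemann ha x).const_add (2 * δ)).sub_const (dist x m)
    have hy := ((hB.tendsto_busemann ha y).const_add (2 * δ)).sub_const (dist m y)
    refine le_of_tendsto_of_tendsto' (hB.tendsto_busemann ha m) (hx.max hy) fun t => ?_
    obtain ⟨u, hu, hmu⟩ := hH.exists_near hm (a t)
    rcases hu with hu | hu
    · refine le_max_of_le_left ?_
      have := hu.dist_add
      have h1 := dist_triangle x u m
      have h2 := dist_triangle m u (a t)
      rw [dist_comm u m] at h1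
      linarith
    · refine le_max_of_le_right ?_
      have := hu.dist_add
      have h1 := dist_triangle m u y
      have h2 := dist_triangle m u (a t)
      rw [dist_comm u (a t)] at h2
      rw [dist_comm y (a t)]
      linarith
  simp only [height]
  rcases le_max_iff.1 hle with h | h
  · linarith [min_le_left (-busemann w a x + dist x m) (-busemann w a y + dist m y)]
  · linarith [min_le_right (-busemann w a x + dist x m) (-busemann w a y + dist m y)]

/-- A point `m` of `[x, y]` is `2 * δ`-close to `[u, v]` as soon as `u` and `v` project well
before and well after `m`. -/
theorem DeltaHyperbolic.exists_near_of_project {δ R : ℝ} (hH : DeltaHyperbolic H δ)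
    (hR : 2 * δ < R) {x y m u v : H} (hm : OnGeodSegment x y m)
    (hu : dist x u - dist u y = dist x m - dist m y - 2 * R)
    (hv : dist x v - dist v y = dist x m - dist m y + 2 * R) :
    ∃ q, OnGeodSegment u v q ∧ dist m q ≤ 2 * δ := by
  have hfar_u : ∀ q, OnGeodSegment x u q → ¬ dist m q ≤ 2 * δ := by
    intro q hq hmq
    have h1 := hq.dist_add
    have h2 := dist_triangle x q m
    have h3 := dist_triangle q m y
    have h4 := dist_triangle u q y
    rw [dist_comm q m] at h2 h3
    rw [dist_comm u q] at h4
    linarith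
  have hfar_v : ∀ q, OnGeodSegment v y q → ¬ dist m q ≤ 2 * δ := by
    intro q hq hmq
    have h1 := hq.dist_add
    have h2 := dist_triangle x m q
    have h3 := dist_triangle x q v
    have h4 := dist_triangle m q y
    rw [dist_comm q v] at h3
    linarith
  obtain ⟨p, hp, hmp⟩ := hH.exists_near hm v
  have hδ0 : 0 ≤ δ := dist_nonneg.trans hmp
  rcases hp with hp | hp
  · obtain ⟨q, hq, hpq⟩ := hH.exists_near hp u
    have hmq : dist m q ≤ 2 * δ := by linarith [dist_triangle m p q]
    rcases hq with hq | hq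
    · exact absurd hmq (hfar_u q hq)
    · exact ⟨q, hq, hmq⟩
  · exact absurd (by linarith) (hfar_v p hp)

theorem rpow_div_le_two_pow_floor {δ ΔH : ℝ} (hδ : 1 ≤ δ) (hΔH : 555 * δ < ΔH) :
    ∃ n : ℕ, n * δ + 6 * δ ≤ ΔH ∧ (2 : ℝ) ^ (-(530 : ℝ)) * 2 ^ (ΔH / δ) ≤ 2 ^ n := by
  have hδ0 : 0 < δ := by linarith
  have h555 : 555 < ΔH / δ := (lt_div_iff₀ hδ0).2 hΔH
  refine ⟨⌊ΔH / δ - 6⌋₊, ?_, ?_⟩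
  · have h := Nat.floor_le (show 0 ≤ ΔH / δ - 6 by linarith)
    have h2 : (⌊ΔH / δ - 6⌋₊ + 6 : ℝ) * δ ≤ ΔH := (le_div_iff₀ hδ0).1 (by linarith)
    linarith
  · have h := Nat.lt_floor_add_one (ΔH / δ - 6)
    rw [← Real.rpow_add two_pos, ← Real.rpow_natCast]
    exact Real.rpow_le_rpow_of_exponent_le one_le_two (by linarith)

/-- Exponential lower bound on the length of a path which stays at
least `ΔH` below the height `h(y) + ½ d_r(x,y)`. -/
theorem statement7 {H : Type*} [MetricSpace H] [ProperSpace H]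
    (δ : ℝ) (hδ : 1 ≤ δ) (hH : DeltaHyperbolic H δ) (hB : BusemannSpace H)
    (w : H) (a : ℝ → H) (ha : IsRayFrom w a)
    (x y : H) (hxy : height w a x ≤ height w a y)
    (ΔH : ℝ) (hΔH : 555 * δ < ΔH)
    (T : ℝ) (hT : 0 ≤ T) (α : ℝ → H) (hαc : ContinuousOn α (Set.Icc 0 T))
    (hα0 : α 0 = x) (hαT : α T = y)
    (hbelow : ∀ t ∈ Set.Icc (0:ℝ) T,
        height w a (α t) ≤ height w a y + dr w a x y / 2 - ΔH) :
    ENNReal.ofReal (dist x y + 2 ^ (-(530:ℝ)) * 2 ^ (ΔH / δ) - 2 * ΔH - 24 * δ)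
      ≤ eVariationOn α (Set.Icc 0 T) := by
  have hd : dist x y = dh w a x y + dr w a x y := by rw [dr]; ring
  have hdh : dh w a x y = height w a y - height w a x := by
    rw [dh, abs_sub_comm, abs_of_nonneg (by linarith)]
  have hdr : ΔH ≤ dr w a x y / 2 := by
    have := hbelow T ⟨hT, le_rfl⟩
    rw [hαT] at this
    linarith
  obtain ⟨γ, hγ⟩ := hH.1 x y
  set M := dh w a x y + dr w a x y / 2 with hM
  have hMmem : M ∈ Set.Icc 0 (dist x y) := ⟨by linarith, by linarith⟩
  have hm : OnGeodSegment x y (γ M) := ⟨γ, hγ, M, hMmem, rfl⟩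
  have hxm := hγ.dist_left hMmem
  have hmy := hγ.dist_right hMmem
  have hfar : ∀ t ∈ Set.Icc 0 T, ΔH - 2 * δ ≤ dist (γ M) (α t) := by
    intro t ht
    have h1 := hH.min_height_le hB ha hm
    have h2 := hB.height_sub_le_dist ha (γ M) (α t)
    have h3 := hbelow t ht
    have h4 : height w a y + dr w a x y / 2 ≤
        min (height w a x + dist x (γ M)) (height w a y + dist (γ M) y) :=
      le_min (by linarith) (by linarith)
    linarith
  have hf : ContinuousOn (fun t => dist x (α t) - dist (α t) y) (Set.Icc 0 T) := by
    fun_prop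
  obtain ⟨t₁, ht₁, hu⟩ := intermediate_value_Icc hT hf
    (show 2 * M - dist x y - 2 * ΔH ∈ _ from
      ⟨by simp only [hα0, dist_self]; linarith, by simp only [hαT, dist_self]; linarith⟩)
  obtain ⟨t₂, ht₂, hv⟩ := intermediate_value_Icc ht₁.2
    (hf.mono (Set.Icc_subset_Icc_left ht₁.1))
    (show 2 * M - dist x y + 2 * ΔH ∈ _ from
      ⟨hu.le.trans (by linarith), by simp only [hαT, dist_self]; linarith⟩)
  dsimp only at hu hv
  obtain ⟨q, hq, hmq⟩ := hH.exists_near_of_project (R := ΔH) (by linarith) hm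
    (by linarith : dist x (α t₁) - dist (α t₁) y = _) (by linarith)
  obtain ⟨n, hn, hpow⟩ := rpow_div_le_two_pow_floor hδ hΔH
  have hmid : (2 : ℝ≥0∞) ^ n < eVariationOn α (Set.Icc t₁ t₂) := by
    by_contra! hle
    obtain ⟨r, hr, hdist⟩ := hH.exists_near_path n ht₂.1
      (hαc.mono (Set.Icc_subset_Icc ht₁.1 ht₂.2)) hle hq
    have h1 := hfar r ⟨ht₁.1.trans hr.1, hr.2.trans ht₂.2⟩
    linarith [dist_triangle (γ M) q (α r)]
  have hleft : ENNReal.ofReal (dist x (α t₁)) ≤ eVariationOn α (Set.Icc 0 t₁) := by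
    rw [← edist_dist, ← hα0]
    exact eVariationOn.edist_le α ⟨le_rfl, ht₁.1⟩ ⟨ht₁.1, le_rfl⟩
  have hright : ENNReal.ofReal (dist (α t₂) y) ≤ eVariationOn α (Set.Icc t₂ T) := by
    rw [← edist_dist, ← hαT]
    exact eVariationOn.edist_le α ⟨le_rfl, ht₂.2⟩ ⟨ht₂.2, le_rfl⟩
  have htri₁ := dist_triangle x (α t₁) y
  have htri₂ := dist_triangle x (α t₂) y
  calc _ ≤ ENNReal.ofReal (dist x (α t₁) + 2 ^ n + dist (α t₂) y) :=
        ENNReal.ofReal_le_ofReal (by linarith)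
    _ = ENNReal.ofReal (dist x (α t₁)) + 2 ^ n + ENNReal.ofReal (dist (α t₂) y) := by
        rw [ENNReal.ofReal_add (by positivity) dist_nonneg,
          ENNReal.ofReal_add dist_nonneg (by positivity), ENNReal.ofReal_pow zero_le_two]
        simp
    _ ≤ eVariationOn α (Set.Icc 0 t₁) + eVariationOn α (Set.Icc t₁ t₂)
          + eVariationOn α (Set.Icc t₂ T) := by gcongr
    _ = eVariationOn α (Set.Icc 0 T) := by
        rw [eVariationOn_Icc_add_Icc α ht₁.1 ht₂.1,
          eVariationOn_Icc_add_Icc α (ht₁.1.trans ht₂.1) ht₂.2]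

end HP

end
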